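/- Let u0 and u1 be moment functionals on ℂ[x] with MOPS {P_n} and {R_n} respectively, let λ ≠ 0, and let {S_n} be an MOPS relative to the Sobolev form φ_λ. Assume relation (3.1) holds with σ̃_n = 0 and μ_n = 0 for all n, i.e. P_{n+1} − τ̃_{n−1} P_{n−1} = S_{n+1} − θ_{n−1} S_{n−1} for all n ≥ 0 (with τ̃_{−1} = θ_{−1} = 0). Then {u0, u1} is an extended symmetric coherent pair: there exists a complex sequence ẽ_n with ẽ_0 = ẽ_{−1} = 0 such that (n+1)·R_n − ẽ_{n−1}·R_{n−2} = P′_{n+1} − τ̃_{n−1}·P′_{n−1} for all n ≥ 0. -/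

import Mathlib

open Polynomial

noncomputable section

/-- A monic orthogonal polynomial system (MOPS) relative to a moment functional `u`,
indexed by `ℤ` with the convention `P n = 0` for `n < 0`. -/
def IsMOPS (u : Polynomial ℂ →ₗ[ℂ] ℂ) (P : ℤ → Polynomial ℂ) : Prop :=
  (∀ n : ℤ, n < 0 → P n = 0) ∧
  (∀ n : ℤ, 0 ≤ n → (P n).Monic ∧ (P n).natDegree = n.toNat) ∧
  (∀ m n : ℤ, 0 ≤ m → 0 ≤ n → m ≠ n → u (P m * P n) = 0) ∧
  (∀ n : ℤ, 0 ≤ n → u (P n ^ 2) ≠ 0)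

/-- The Sobolev bilinear form `φ_λ(f,g) = ⟨u0, f·g⟩ + λ·⟨u1, f'·g'⟩`. -/
def sobolev (u0 u1 : Polynomial ℂ →ₗ[ℂ] ℂ) (lam : ℂ) (f g : Polynomial ℂ) : ℂ :=
  u0 (f * g) + lam * u1 (derivative f * derivative g)

/-- An MOPS relative to the Sobolev form `φ_λ`. -/
def IsSobolevMOPS (u0 u1 : Polynomial ℂ →ₗ[ℂ] ℂ) (lam : ℂ) (S : ℤ → Polynomial ℂ) : Prop :=
  (∀ n : ℤ, n < 0 → S n = 0) ∧
  (∀ n : ℤ, 0 ≤ n → (S n).Monic ∧ (S n).natDegree = n.toNat) ∧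
  (∀ m n : ℤ, 0 ≤ m → 0 ≤ n → m ≠ n → sobolev u0 u1 lam (S m) (S n) = 0) ∧
  (∀ n : ℤ, 0 ≤ n → sobolev u0 u1 lam (S n) (S n) ≠ 0)

/-- A linear functional vanishing on polynomials of exact degrees `0, …, N - 1` vanishes on all
polynomials of degree less than `N`. -/
theorem map_eq_zero_of_degree_lt (L : ℂ[X] →ₗ[ℂ] ℂ) (B : ℕ → ℂ[X])
    (hB : ∀ k, (B k).degree = k) (N : ℕ) (hL : ∀ k < N, L (B k) = 0) :
    ∀ g : ℂ[X], g.degree < N → L g = 0 := by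
  induction N with
  | zero =>
    intro g hg
    have hg0 : g = 0 := by simpa using hg
    simp [hg0]
  | succ N ih =>
    intro g hg
    have hlead : (B N).coeff N ≠ 0 := coeff_ne_zero_of_eq_degree (hB N)
    have hlow : (g - (g.coeff N / (B N).coeff N) • B N).degree < N := by
      rw [degree_lt_iff_coeff_zero] at hg ⊢
      intro m hm
      rcases hm.eq_or_lt with rfl | hlt
      · simp [hlead]
      · have hBm : (B N).coeff m = 0 :=
          coeff_eq_zero_of_degree_lt (by rw [hB]; exact_mod_cast hlt)
        simp [hg m hlt, hBm]
    have h := ih (fun k hk => hL k (by omega)) _ hlow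
    simpa [hL N (by omega)] using h

namespace IsMOPS

variable {u : ℂ[X] →ₗ[ℂ] ℂ} {P : ℤ → ℂ[X]}

theorem map_mul_eq_zero (h : IsMOPS u P) {m n : ℤ} (hmn : m ≠ n) : u (P m * P n) = 0 := by
  rcases lt_or_ge m 0 with hm | hm
  · simp [h.1 m hm]
  rcases lt_or_ge n 0 with hn | hn
  · simp [h.1 n hn]
  exact h.2.2.1 m n hm hn hmn

theorem coeff_of_lt (h : IsMOPS u P) {n : ℤ} {k : ℕ} (hk : n < k) : (P n).coeff k = 0 := by
  rcases lt_or_ge n 0 with hn | hn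
  · simp [h.1 n hn]
  · exact coeff_eq_zero_of_natDegree_lt (by rw [(h.2.1 n hn).2]; omega)

theorem coeff_self (h : IsMOPS u P) {n : ℤ} {k : ℕ} (hk : n = k) : (P n).coeff k = 1 := by
  have hn := h.2.1 n (by omega)
  have hd : (P n).natDegree = k := by rw [hn.2]; omega
  rw [← hd]
  exact hn.1

theorem degree_natCast (h : IsMOPS u P) (k : ℕ) : (P k).degree = k := by
  have hk := h.2.1 k (by omega)
  rw [degree_eq_natDegree hk.1.ne_zero, hk.2]
  simp

/-- A polynomial of degree less than `N` orthogonal to the first `N` terms of an MOPS is zero. -/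
theorem eq_zero_of_orthogonal (h : IsMOPS u P) {N : ℕ} {D : ℂ[X]} (hD : D.degree < N)
    (horth : ∀ k : ℕ, k < N → u (D * P k) = 0) : D = 0 := by
  by_contra hne
  have hdN : D.natDegree < N := (natDegree_lt_iff_degree_lt hne).2 hD
  set d := D.natDegree with hd
  have hlow : (P d - (D.coeff d)⁻¹ • D).degree < d := by
    have hlead : D.coeff d ≠ 0 := leadingCoeff_ne_zero.2 hne
    rw [degree_lt_iff_coeff_zero]
    intro m hm
    rcases hm.eq_or_lt with heq | hlt
    · rw [← heq, coeff_sub, coeff_smul, h.coeff_self rfl]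
      simp [hlead]
    · rw [coeff_sub, coeff_smul, h.coeff_of_lt (by exact_mod_cast hlt),
        coeff_eq_zero_of_natDegree_lt (p := D) hlt]
      simp
  have hzero := map_eq_zero_of_degree_lt (u ∘ₗ LinearMap.mulLeft ℂ (P d)) (fun k => P k)
    h.degree_natCast d (fun k hk => h.map_mul_eq_zero (by omega)) _ hlow
  apply h.2.2.2 d (by omega)
  have horthd : u (P d * D) = 0 := by rw [mul_comm]; exact horth d hdN
  simpa [mul_sub, horthd, pow_two] using hzero

end IsMOPS

section Coherence

variable {τ' θ : ℤ → ℂ} {u0 u1 : ℂ[X] →ₗ[ℂ] ℂ} {lam : ℂ} {P R S : ℤ → ℂ[X]}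

/-- `S k` lies in the span of `P k, P (k - 2), …`. -/
theorem map_mul_sobolev_eq_zero (hP : IsMOPS u0 P) (hS : IsSobolevMOPS u0 u1 lam S)
    (h31 : ∀ n : ℤ, 0 ≤ n →
      P (n + 1) - τ' (n - 1) • P (n - 1) = S (n + 1) - θ (n - 1) • S (n - 1))
    {m k : ℤ} (hmk : k < m ∨ Odd (m - k)) : u0 (P m * S k) = 0 := by
  suffices H : ∀ N : ℕ, ∀ k : ℤ, k < N → (k < m ∨ Odd (m - k)) → u0 (P m * S k) = 0 from
    H (k + 1).toNat k (by omega) hmk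
  intro N
  induction N with
  | zero =>
    intro k hk _
    simp [hS.1 k (by simpa using hk)]
  | succ N ih =>
    intro k hk hmk
    rcases lt_trichotomy k 0 with hneg | rfl | hpos
    · simp [hS.1 k hneg]
    · have hS0 := hS.2.1 0 le_rfl
      have hP0 := hP.2.1 0 le_rfl
      have heq : S 0 = P 0 := by
        rw [hS0.1.natDegree_eq_zero.1 (by simpa using hS0.2),
          hP0.1.natDegree_eq_zero.1 (by simpa using hP0.2)]
      rw [heq]
      exact hP.map_mul_eq_zero (by grind)
    · have hrel := h31 (k - 1) (by omega)
      have hk2 : k - 1 - 1 = k - 2 := by ring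
      rw [sub_add_cancel, hk2] at hrel
      have hSk : S k = P k - τ' (k - 2) • P (k - 2) + θ (k - 2) • S (k - 2) := by
        rw [hrel]; abel
      have hprev : u0 (P m * S (k - 2)) = 0 := ih _ (by omega) (by grind)
      have hsame : u0 (P m * P k) = 0 := hP.map_mul_eq_zero (by grind)
      have hdown : u0 (P m * P (k - 2)) = 0 := hP.map_mul_eq_zero (by grind)
      rw [hSk]
      simp [mul_add, mul_sub, hprev, hsame, hdown]

theorem map_derivative_mul_eq_zero (hlam : lam ≠ 0) (hP : IsMOPS u0 P)
    (hS : IsSobolevMOPS u0 u1 lam S)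
    (h31 : ∀ n : ℤ, 0 ≤ n →
      P (n + 1) - τ' (n - 1) • P (n - 1) = S (n + 1) - θ (n - 1) • S (n - 1))
    {n k : ℤ} (hn : 0 ≤ n) (hk : k = n ∨ k < n - 1) :
    u1 (derivative (P (n + 1) - τ' (n - 1) • P (n - 1)) * derivative (S k)) = 0 := by
  have horth : ∀ m : ℤ, m ≠ k → sobolev u0 u1 lam (S m) (S k) = 0 := by
    intro m hm
    rcases lt_or_ge m 0 with hm0 | hm0
    · simp [sobolev, hS.1 m hm0]
    rcases lt_or_ge k 0 with hk0 | hk0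
    · simp [sobolev, hS.1 k hk0]
    exact hS.2.2.1 m k hm0 hk0 hm
  have hφ : sobolev u0 u1 lam (P (n + 1) - τ' (n - 1) • P (n - 1)) (S k) = 0 := by
    have hup := horth (n + 1) (by omega)
    have hdown := horth (n - 1) (by omega)
    rw [h31 n hn]
    simp only [sobolev, sub_mul, smul_mul_assoc, map_sub, map_smul, smul_eq_mul] at hup hdown ⊢
    linear_combination hup - θ (n - 1) * hdown
  have hup : u0 (P (n + 1) * S k) = 0 :=
    map_mul_sobolev_eq_zero hP hS h31 (by grind)
  have hdown : u0 (P (n - 1) * S k) = 0 :=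
    map_mul_sobolev_eq_zero hP hS h31 (by grind)
  have hu0 : u0 ((P (n + 1) - τ' (n - 1) • P (n - 1)) * S k) = 0 := by
    simp [sub_mul, hup, hdown]
  rw [sobolev, hu0, zero_add] at hφ
  exact (mul_eq_zero.1 hφ).resolve_left hlam

theorem map_derivative_mul_eq_zero_of_degree_lt (hlam : lam ≠ 0) (hP : IsMOPS u0 P)
    (hS : IsSobolevMOPS u0 u1 lam S)
    (h31 : ∀ n : ℤ, 0 ≤ n →
      P (n + 1) - τ' (n - 1) • P (n - 1) = S (n + 1) - θ (n - 1) • S (n - 1))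
    {n : ℕ} {g : ℂ[X]} (hg : g.degree < (n - 2 : ℕ)) :
    u1 (derivative (P (n + 1) - τ' (n - 1) • P (n - 1)) * g) = 0 := by
  refine map_eq_zero_of_degree_lt (u1 ∘ₗ LinearMap.mulLeft ℂ
    (derivative (P (n + 1) - τ' (n - 1) • P (n - 1)))) (fun k => derivative (S (k + 1)))
    (fun k => ?_) (n - 2)
    (fun k hk => map_derivative_mul_eq_zero hlam hP hS h31 (by omega) (by omega)) g hg
  have hdeg : (S (k + 1)).natDegree = k + 1 := by
    rw [(hS.2.1 (k + 1) (by omega)).2]; omega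
  rw [degree_derivative (by omega), hdeg, Nat.add_sub_cancel]

theorem degree_derivative_sub_lt (hP : IsMOPS u0 P) (hR : IsMOPS u1 R) (t e : ℂ) (n : ℕ) :
    (derivative (P (n + 1) - t • P (n - 1)) - (((n : ℂ) + 1) • R n - e • R (n - 2))).degree
      < n := by
  rw [degree_lt_iff_coeff_zero]
  intro m hm
  simp only [coeff_sub, coeff_derivative, coeff_smul]
  rw [hP.coeff_of_lt (n := n - 1) (by push_cast; omega), hR.coeff_of_lt (n := n - 2) (by omega)]
  rcases hm.eq_or_lt with rfl | hlt
  · rw [hP.coeff_self (by push_cast; rfl), hR.coeff_self rfl]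
    simp
  · rw [hP.coeff_of_lt (by push_cast; omega), hR.coeff_of_lt (by omega)]
    simp

theorem exists_derivative_eq_of_orthogonal (hlam : lam ≠ 0) (hP : IsMOPS u0 P) (hR : IsMOPS u1 R)
    (hS : IsSobolevMOPS u0 u1 lam S)
    (h31 : ∀ n : ℤ, 0 ≤ n →
      P (n + 1) - τ' (n - 1) • P (n - 1) = S (n + 1) - θ (n - 1) • S (n - 1)) (n : ℕ)
    (horth : u1 (derivative (P (n + 1) - τ' (n - 1) • P (n - 1)) * R (n - 1)) = 0) :
    ∃ e : ℂ, (n < 2 → e = 0) ∧ ((n : ℂ) + 1) • R n - e • R (n - 2)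
      = derivative (P (n + 1) - τ' (n - 1) • P (n - 1)) := by
  set Q := P (n + 1) - τ' (n - 1) • P (n - 1) with hQ
  refine ⟨-u1 (derivative Q * R (n - 2)) / u1 (R (n - 2) ^ 2), fun hn => ?_, ?_⟩
  · simp [hR.1 (n - 2) (by omega)]
  set e := -u1 (derivative Q * R (n - 2)) / u1 (R (n - 2) ^ 2) with he
  refine (sub_eq_zero.1 (hR.eq_zero_of_orthogonal
    (degree_derivative_sub_lt hP hR (τ' (n - 1)) e n) fun k hk => ?_)).symm
  rw [← hQ]
  have hRn : u1 (R n * R k) = 0 := hR.map_mul_eq_zero (by omega)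
  by_cases hk2 : (k : ℤ) = n - 2
  · have hne : u1 (R (n - 2) ^ 2) ≠ 0 := hR.2.2.2 _ (by omega)
    rw [hk2] at hRn ⊢
    simp only [sub_mul, smul_mul_assoc, map_sub, map_smul, smul_eq_mul, hRn, ← pow_two]
    rw [he]
    field_simp
    ring
  · have hR2 : u1 (R (n - 2) * R k) = 0 := hR.map_mul_eq_zero (Ne.symm hk2)
    have hQk : u1 (derivative Q * R k) = 0 := by
      by_cases hk1 : (k : ℤ) = n - 1
      · rw [hk1]; exact horth
      · refine map_derivative_mul_eq_zero_of_degree_lt hlam hP hS h31 ?_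
        rw [hR.degree_natCast]
        exact_mod_cast (by omega : k < n - 2)
    simp [sub_mul, hRn, hR2, hQk]

theorem exists_derivative_eq (hlam : lam ≠ 0) (hP : IsMOPS u0 P) (hR : IsMOPS u1 R)
    (hS : IsSobolevMOPS u0 u1 lam S)
    (h31 : ∀ n : ℤ, 0 ≤ n →
      P (n + 1) - τ' (n - 1) • P (n - 1) = S (n + 1) - θ (n - 1) • S (n - 1)) (n : ℕ) :
    ∃ e : ℂ, (n < 2 → e = 0) ∧ ((n : ℂ) + 1) • R n - e • R (n - 2)
      = derivative (P (n + 1) - τ' (n - 1) • P (n - 1)) := by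
  induction n with
  | zero =>
    refine exists_derivative_eq_of_orthogonal hlam hP hR hS h31 0 ?_
    rw [hR.1 _ (by simp), mul_zero, map_zero]
  | succ m ih =>
    refine exists_derivative_eq_of_orthogonal hlam hP hR hS h31 (m + 1) ?_
    obtain ⟨e, -, he⟩ := ih
    have hself := map_derivative_mul_eq_zero hlam hP hS h31 (n := (m + 1 : ℕ)) (k := m + 1)
      (by omega) (by omega)
    have hprev := map_derivative_mul_eq_zero hlam hP hS h31 (n := (m + 1 : ℕ)) (k := m - 1)
      (by omega) (by omega)
    have hlow : u1 (derivative (P ((m + 1 : ℕ) + 1) - τ' ((m + 1 : ℕ) - 1) •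
        P ((m + 1 : ℕ) - 1)) * R (m - 2)) = 0 := by
      rcases lt_or_ge m 2 with hm | hm
      · rw [hR.1 _ (by omega), mul_zero, map_zero]
      · obtain ⟨j, rfl⟩ := Nat.exists_eq_add_of_le' hm
        refine map_derivative_mul_eq_zero_of_degree_lt hlam hP hS h31 ?_
        rw [show ((j + 2 : ℕ) : ℤ) - 2 = j by push_cast; ring, hR.degree_natCast]
        exact_mod_cast (by omega : j < j + 2 + 1 - 2)
    rw [h31 m (by omega)] at he
    set Q := P ((m + 1 : ℕ) + 1) - τ' ((m + 1 : ℕ) - 1) • P ((m + 1 : ℕ) - 1)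
    have h := congrArg (fun q => u1 (derivative Q * q)) he
    simp only [mul_sub, mul_smul_comm, map_sub, map_smul, hself, hprev, hlow, smul_eq_mul,
      mul_zero, sub_zero] at h
    rw [show ((m + 1 : ℕ) : ℤ) - 1 = m by push_cast; ring]
    exact (mul_eq_zero.1 h).resolve_left m.cast_add_one_ne_zero

end Coherence

/-- extended symmetric coherent pair case. -/
theorem stmt15
    (u0 u1 : Polynomial ℂ →ₗ[ℂ] ℂ) (lam : ℂ) (hlam : lam ≠ 0)
    (P R S : ℤ → Polynomial ℂ)
    (hP : IsMOPS u0 P) (hR : IsMOPS u1 R) (hS : IsSobolevMOPS u0 u1 lam S)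
    (τ' θ : ℤ → ℂ) (hτ' : τ' (-1) = 0) (hθ : θ (-1) = 0)
    (h31 : ∀ n : ℤ, 0 ≤ n →
      P (n + 1) - τ' (n - 1) • P (n - 1) = S (n + 1) - θ (n - 1) • S (n - 1)) :
    ∃ e' : ℤ → ℂ, e' 0 = 0 ∧ e' (-1) = 0 ∧
      ∀ n : ℤ, 0 ≤ n →
        ((n : ℂ) + 1) • R n - e' (n - 1) • R (n - 2)
          = derivative (P (n + 1)) - τ' (n - 1) • derivative (P (n - 1)) := by
  choose e he_low he using exists_derivative_eq hlam hP hR hS h31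
  refine ⟨fun m => e (m + 1).toNat, he_low _ (by norm_num), he_low _ (by norm_num),
    fun n hn => ?_⟩
  lift n to ℕ using hn
  simpa using he n
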